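/- arXiv:2603.02933 — 5 statements merged into one kernel-verified Lean document; each statement's English description precedes it below -/
import Mathlib

section
/- For every spin configuration σ ∈ {−1,+1}^N, the matrix J_DIM(σ) − D − W is negative semidefinite and satisfies (J_DIM(σ) − D − W)σ = 0; in particular, its largest eigenvalue equals 0. -/
open Matrix Finset

/-- Degree matrix `D = diag(d_1, …, d_N)` with `d_i = Σ_j W i j`. -/
noncomputable def degMat {N : ℕ} (W : Matrix (Fin N) (Fin N) ℝ) : Matrix (Fin N) (Fin N) ℝ :=
  Matrix.diagonal (fun i => ∑ j, W i j)

/-- `μ` is the largest eigenvalue of `A`. -/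
def IsMaxEig {N : ℕ} (A : Matrix (Fin N) (Fin N) ℝ) (μ : ℝ) : Prop :=
  (∃ v : Fin N → ℝ, v ≠ 0 ∧ A.mulVec v = μ • v) ∧
  ∀ ν : ℝ, (∃ v : Fin N → ℝ, v ≠ 0 ∧ A.mulVec v = ν • v) → ν ≤ μ

/-- DIM Jacobian: `[J_DIM(σ)]_{ij} = σ_i σ_j W_ij` for `i ≠ j`,
`[J_DIM(σ)]_{ii} = Σ_k σ_i σ_k W_ik`. -/
noncomputable def JDIM {N : ℕ} (W : Matrix (Fin N) (Fin N) ℝ) (σ : Fin N → ℝ) :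
    Matrix (Fin N) (Fin N) ℝ :=
  fun i j => if i = j then ∑ k, σ i * σ k * W i k else σ i * σ j * W i j

/-- `-(JDIM W σ - degMat W - W)` is the signless Laplacian of the weights `(1 - σ i * σ j) * W i j`. -/
lemma JDIM_sub_mulVec {N : ℕ} (W : Matrix (Fin N) (Fin N) ℝ) (hdiag : ∀ i, W i i = 0)
    (σ v : Fin N → ℝ) (i : Fin N) :
    (JDIM W σ - degMat W - W).mulVec v i =
      -∑ j, (1 - σ i * σ j) * W i j * (v i + v j) := by
  have hentry : ∀ j, (JDIM W σ - degMat W - W) i j =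
      (if i = j then -∑ k, (1 - σ i * σ k) * W i k else 0) - (1 - σ i * σ j) * W i j := by
    intro j
    by_cases h : i = j
    · subst h
      simp [JDIM, degMat, hdiag, sub_mul, Finset.sum_sub_distrib]
    · simp [JDIM, degMat, h]
      ring
  simp only [Matrix.mulVec, dotProduct, hentry, sub_mul _ _ (v _), ite_mul, zero_mul,
    Finset.sum_sub_distrib, Finset.sum_ite_eq, Finset.mem_univ, if_true, mul_add,
    Finset.sum_add_distrib, ← Finset.sum_mul]
  ring

/-- The quadratic form of a signless Laplacian as a sum of squares. -/
lemma sum_mul_signless {ι : Type*} [Fintype ι] (B : ι → ι → ℝ) (hB : ∀ i j, B i j = B j i)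
    (x : ι → ℝ) :
    2 * ∑ i, x i * ∑ j, B i j * (x i + x j) = ∑ i, ∑ j, B i j * (x i + x j) ^ 2 := by
  have hswap : ∑ i, ∑ j, x i * (B i j * (x i + x j)) =
      ∑ i, ∑ j, x j * (B i j * (x i + x j)) := by
    rw [Finset.sum_comm]
    refine Finset.sum_congr rfl fun i _ => Finset.sum_congr rfl fun j _ => ?_
    rw [hB j i, add_comm (x j)]
  calc 2 * ∑ i, x i * ∑ j, B i j * (x i + x j)
      = ∑ i, ∑ j, x i * (B i j * (x i + x j)) + ∑ i, ∑ j, x j * (B i j * (x i + x j)) := by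
        rw [← hswap, two_mul]
        simp only [Finset.mul_sum]
    _ = ∑ i, ∑ j, B i j * (x i + x j) ^ 2 := by
        simp only [← Finset.sum_add_distrib]
        refine Finset.sum_congr rfl fun i _ => Finset.sum_congr rfl fun j _ => ?_
        ring

/-- for every spin configuration `σ`, the matrix
`J_DIM(σ) − D − W` is negative semidefinite, annihilates `σ`, and its largest
eigenvalue equals `0`. -/
theorem stmt2 {N : ℕ} (hN : 0 < N) (W : Matrix (Fin N) (Fin N) ℝ)
    (hsymm : W.IsSymm) (h01 : ∀ i j, W i j = 0 ∨ W i j = 1)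
    (hdiag : ∀ i, W i i = 0)
    (σ : Fin N → ℝ) (hσ : ∀ i, σ i = 1 ∨ σ i = -1) :
    (-(JDIM W σ - degMat W - W)).PosSemidef ∧
    (JDIM W σ - degMat W - W).mulVec σ = 0 ∧
    IsMaxEig (JDIM W σ - degMat W - W) 0 := by
  have hsym : ∀ i j, W i j = W j i := fun i j => hsymm.apply j i
  have hker : (JDIM W σ - degMat W - W).mulVec σ = 0 := by
    ext i
    rw [JDIM_sub_mulVec W hdiag, Pi.zero_apply, neg_eq_zero]
    refine Finset.sum_eq_zero fun j _ => ?_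
    rcases hσ i with hi | hi <;> rcases hσ j with hj | hj <;> simp [hi, hj]
  have hherm : (-(JDIM W σ - degMat W - W)).IsHermitian := by
    ext i j
    by_cases h : i = j
    · subst h
      simp
    · simp [JDIM, degMat, h, Ne.symm h, hsym i j, mul_comm (σ i)]
  have hnonneg : ∀ x : Fin N → ℝ, 0 ≤ x ⬝ᵥ (-(JDIM W σ - degMat W - W)).mulVec x := by
    intro x
    have hform := sum_mul_signless (fun i j => (1 - σ i * σ j) * W i j)
      (fun i j => by rw [hsym i j, mul_comm (σ i)]) x
    have hsq : 0 ≤ ∑ i, ∑ j, (1 - σ i * σ j) * W i j * (x i + x j) ^ 2 := by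
      refine Finset.sum_nonneg fun i _ => Finset.sum_nonneg fun j _ =>
        mul_nonneg (mul_nonneg ?_ ?_) (sq_nonneg _)
      · rcases hσ i with hi | hi <;> rcases hσ j with hj | hj <;> norm_num [hi, hj]
      · rcases h01 i j with h | h <;> norm_num [h]
    simp only [dotProduct, Matrix.neg_mulVec, Pi.neg_apply, JDIM_sub_mulVec W hdiag, neg_neg]
    linarith
  refine ⟨.of_dotProduct_mulVec_nonneg hherm fun x => by simpa using hnonneg x, hker,
    ⟨σ, fun h => ?_, by rw [hker, zero_smul]⟩, ?_⟩
  · rcases hσ ⟨0, hN⟩ with h' | h' <;> simp [h] at h'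
  · rintro ν ⟨v, hv, hev⟩
    have hquad := hnonneg v
    rw [Matrix.neg_mulVec, hev, dotProduct_neg, dotProduct_smul, smul_eq_mul] at hquad
    have hpos : 0 < v ⬝ᵥ v := by
      simpa using Matrix.dotProduct_star_self_pos_iff.2 hv
    by_contra! hν
    linarith [mul_pos hν hpos]
end

section
/- For every spin configuration σ ∈ {−1,+1}^N, λ_max(J_DIM(σ)) + λ_max(−(D+W)) ≥ 0; equivalently, for every coupling strength K > 0, the DIM parameter gap Δ_DIM = (K/2)·[λ_max(J_DIM(σ)) + λ_max(−D−W)] is nonnegative. -/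
open Matrix Finset

/-- Rayleigh bound: the largest eigenvalue dominates the quadratic form of a symmetric matrix. -/
theorem IsMaxEig.dotProduct_mulVec_le {N : ℕ} {A : Matrix (Fin N) (Fin N) ℝ} {μ : ℝ}
    (hA : A.IsSymm) (hμ : IsMaxEig A μ) (x : Fin N → ℝ) :
    x ⬝ᵥ A *ᵥ x ≤ μ * (x ⬝ᵥ x) := by
  have hB : (μ • (1 : Matrix (Fin N) (Fin N) ℝ) - A).IsHermitian := by
    rw [Matrix.IsHermitian, Matrix.conjTranspose_eq_transpose_of_trivial]
    simp [hA.eq]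
  have hpos : (μ • (1 : Matrix (Fin N) (Fin N) ℝ) - A).PosSemidef := by
    refine hB.posSemidef_iff_eigenvalues_nonneg.mpr fun i => ?_
    have hne : (hB.eigenvectorBasis i : Fin N → ℝ) ≠ 0 := fun h =>
      hB.eigenvectorBasis.orthonormal.ne_zero i (by ext j; exact congrFun h j)
    have hv := hB.mulVec_eigenvectorBasis i
    have hle := hμ.2 (μ - hB.eigenvalues i) ⟨_, hne, by
      rw [Matrix.sub_mulVec, Matrix.smul_mulVec, Matrix.one_mulVec] at hv
      rw [sub_smul, ← hv, sub_sub_cancel]⟩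
    simp only [Pi.zero_apply]
    linarith
  have h := hpos.dotProduct_mulVec_nonneg x
  rw [star_trivial, Matrix.sub_mulVec, Matrix.smul_mulVec, Matrix.one_mulVec, dotProduct_sub,
    dotProduct_smul, smul_eq_mul] at h
  linarith

theorem degMat_add_isSymm {N : ℕ} {W : Matrix (Fin N) (Fin N) ℝ} (hW : W.IsSymm) :
    (degMat W + W).IsSymm :=
  (Matrix.isSymm_diagonal _).add hW

theorem JDIM_isSymm {N : ℕ} {W : Matrix (Fin N) (Fin N) ℝ} (hW : W.IsSymm) (σ : Fin N → ℝ) :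
    (JDIM W σ).IsSymm := by
  ext i j
  by_cases hij : i = j
  · simp [hij]
  · simp [JDIM, hij, Ne.symm hij, hW.apply i j, mul_comm (σ i)]

/-- The quadratic forms of the DIM Jacobian and of the signless Laplacian agree at `σ`. -/
theorem JDIM_quadratic_eq {N : ℕ} {W : Matrix (Fin N) (Fin N) ℝ} (hdiag : ∀ i, W i i = 0)
    {σ : Fin N → ℝ} (hσ : ∀ i, σ i * σ i = 1) :
    σ ⬝ᵥ JDIM W σ *ᵥ σ = σ ⬝ᵥ (degMat W + W) *ᵥ σ := by
  have hJ : JDIM W σ = Matrix.diagonal (fun i => ∑ k, σ i * σ k * W i k) +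
      Matrix.of (fun i j => σ i * σ j * W i j) := by
    ext i j
    by_cases hij : i = j
    · subst hij; simp [JDIM, hdiag]
    · simp [JDIM, hij]
  rw [hJ, Matrix.add_mulVec, Matrix.add_mulVec, degMat]
  simp only [dotProduct, Pi.add_apply, Matrix.mulVec_diagonal]
  refine Finset.sum_congr rfl fun i _ => ?_
  simp only [Matrix.mulVec, dotProduct, Matrix.of_apply, Finset.sum_mul, ← Finset.sum_add_distrib,
    Finset.mul_sum]
  refine Finset.sum_congr rfl fun j _ => ?_
  linear_combination (σ i * σ j * W i j) * hσ i + (σ i * σ i * W i j) * hσ j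

/-- for every spin configuration `σ`,
`λ_max(J_DIM(σ)) + λ_max(−(D+W)) ≥ 0`; equivalently, for every `K > 0` the
DIM parameter gap `Δ_DIM = (K/2)·[λ_max(J_DIM(σ)) + λ_max(−D−W)]` is
nonnegative. -/
theorem stmt3 {N : ℕ} (hN : 0 < N) (W : Matrix (Fin N) (Fin N) ℝ)
    (hsymm : W.IsSymm) (h01 : ∀ i j, W i j = 0 ∨ W i j = 1)
    (hdiag : ∀ i, W i i = 0)
    (σ : Fin N → ℝ) (hσ : ∀ i, σ i = 1 ∨ σ i = -1)
    (lam₁ lam₂ : ℝ)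
    (hlam₁ : IsMaxEig (JDIM W σ) lam₁)
    (hlam₂ : IsMaxEig (-(degMat W + W)) lam₂) :
    0 ≤ lam₁ + lam₂ ∧ ∀ K : ℝ, 0 < K → 0 ≤ (K/2) * (lam₁ + lam₂) := by
  have hsq : ∀ i, σ i * σ i = 1 := fun i => by rcases hσ i with h | h <;> simp [h]
  have h₁ := hlam₁.dotProduct_mulVec_le (JDIM_isSymm hsymm σ) σ
  have h₂ := hlam₂.dotProduct_mulVec_le (degMat_add_isSymm hsymm).neg σ
  rw [JDIM_quadratic_eq hdiag hsq] at h₁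
  rw [Matrix.neg_mulVec, dotProduct_neg] at h₂
  have hnorm : σ ⬝ᵥ σ = N := by simp [dotProduct, hsq]
  rw [hnorm] at h₁ h₂
  have hN' : (0 : ℝ) < N := Nat.cast_pos.mpr hN
  have hsum : 0 ≤ lam₁ + lam₂ :=
    nonneg_of_mul_nonneg_left (by linarith : 0 ≤ (lam₁ + lam₂) * N) hN'
  exact ⟨hsum, fun K hK => mul_nonneg (half_pos hK).le hsum⟩
end

section
/- Let λ_max denote the largest eigenvalue of the matrix −(D+W). If a spin configuration σ* ∈ {−1,+1}^N is an eigenvector of −(D+W) with eigenvalue λ_max (equivalently, σ* is orthogonal to every eigenvector of −(D+W) whose eigenvalue is strictly less than λ_max), then σ* minimizes the antiferromagnetic Ising energy H over {−1,+1}^N, and H(σ*) = −(N/2)·λ_max − #E(G). -/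
open Matrix Finset

/-- Antiferromagnetic Ising energy `H(σ) = (1/2)·σᵀWσ`. -/
noncomputable def isingH {N : ℕ} (W : Matrix (Fin N) (Fin N) ℝ) (σ : Fin N → ℝ) : ℝ :=
  (1/2) * (σ ⬝ᵥ W.mulVec σ)

/-- Number of edges `#E(G) = (1/2)·Σ_{i,j} W i j`. -/
noncomputable def numEdges {N : ℕ} (W : Matrix (Fin N) (Fin N) ℝ) : ℝ :=
  (1/2) * ∑ i, ∑ j, W i j

theorem isSymm_neg_degMat_add {N : ℕ} {W : Matrix (Fin N) (Fin N) ℝ} (hW : W.IsSymm) :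
    (-(degMat W + W)).IsSymm := by
  simp [Matrix.IsSymm, degMat, hW.eq]

theorem dotProduct_self_of_spin {N : ℕ} {σ : Fin N → ℝ} (hσ : ∀ i, σ i = 1 ∨ σ i = -1) :
    σ ⬝ᵥ σ = N := by
  have h (i : Fin N) : σ i * σ i = 1 := mul_self_eq_one_iff.mpr (hσ i)
  simp [dotProduct, h]

/-- On spin configurations the quadratic form of `-(D + W)` is `-2 (H + #E)`. -/
theorem dotProduct_neg_degMat_add_mulVec {N : ℕ} (W : Matrix (Fin N) (Fin N) ℝ)
    {σ : Fin N → ℝ} (hσ : ∀ i, σ i = 1 ∨ σ i = -1) :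
    σ ⬝ᵥ (-(degMat W + W)) *ᵥ σ = -2 * (isingH W σ + numEdges W) := by
  have hD : σ ⬝ᵥ degMat W *ᵥ σ = ∑ i, ∑ j, W i j := by
    refine Finset.sum_congr rfl fun i _ => ?_
    rw [degMat, mulVec_diagonal, mul_left_comm, mul_self_eq_one_iff.mpr (hσ i), mul_one]
  rw [neg_mulVec, add_mulVec, dotProduct_neg, dotProduct_add, hD, isingH, numEdges]
  ring

/-- if a spin configuration `σ*` is an eigenvector of `−(D+W)`
for its largest eigenvalue `λ_max`, then `σ*` minimizes the antiferromagnetic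
Ising energy over `{−1,+1}^N` and `H(σ*) = −(N/2)·λ_max − #E(G)`. -/
theorem stmt14 {N : ℕ} (hN : 0 < N) (W : Matrix (Fin N) (Fin N) ℝ)
    (hsymm : W.IsSymm) (h01 : ∀ i j, W i j = 0 ∨ W i j = 1)
    (hdiag : ∀ i, W i i = 0)
    (lam : ℝ) (hlam : IsMaxEig (-(degMat W + W)) lam)
    (σstar : Fin N → ℝ) (hspin : ∀ i, σstar i = 1 ∨ σstar i = -1)
    (heig : (-(degMat W + W)).mulVec σstar = lam • σstar) :
    (∀ σ : Fin N → ℝ, (∀ i, σ i = 1 ∨ σ i = -1) → isingH W σstar ≤ isingH W σ) ∧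
    isingH W σstar = -((N : ℝ)/2) * lam - numEdges W := by
  have hval : isingH W σstar = -((N : ℝ)/2) * lam - numEdges W := by
    have h := dotProduct_neg_degMat_add_mulVec W hspin
    rw [heig, dotProduct_smul, dotProduct_self_of_spin hspin, smul_eq_mul] at h
    linarith
  refine ⟨fun σ hσ => ?_, hval⟩
  have h := hlam.dotProduct_mulVec_le (isSymm_neg_degMat_add hsymm) σ
  rw [dotProduct_neg_degMat_add_mulVec W hσ, dotProduct_self_of_spin hσ] at h
  linarith
end

section
/- Assume λ̃_i + c ≥ 0 for every i = 1,…,N and Δ_HyIM(α) > 0. If the degree of synchronization satisfies S(v_max) > 1 − ΔH/(N·Δ_HyIM(α)), then the binarized dominant eigenvector satisfies H(σ_max) < H₁, i.e., its Ising energy lies strictly below the first excited level. -/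
open Matrix Finset

/-- OIM Jacobian. -/
noncomputable def JOIM {N : ℕ} (W : Matrix (Fin N) (Fin N) ℝ) (σ : Fin N → ℝ) :
    Matrix (Fin N) (Fin N) ℝ :=
  fun i j => if i = j then ∑ k, σ i * σ k * W i k else -(σ i * σ j * W i j)

/-- HyIM Jacobian `J_HyIM(σ,α) = α·J_DIM(σ) + (1−α)·J_OIM(σ)`. -/
noncomputable def JHyIM {N : ℕ} (W : Matrix (Fin N) (Fin N) ℝ) (σ : Fin N → ℝ) (α : ℝ) :
    Matrix (Fin N) (Fin N) ℝ :=
  α • JDIM W σ + (1 - α) • JOIM W σ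

/-- Parseval's identity for an orthonormal family of `n` vectors in `ℝⁿ`. -/
theorem dotProduct_eq_sum_of_orthonormal {n : ℕ} {v : Fin n → Fin n → ℝ}
    (horth : ∀ i j, v i ⬝ᵥ v j = if i = j then (1 : ℝ) else 0) (x y : Fin n → ℝ) :
    x ⬝ᵥ y = ∑ i, (v i ⬝ᵥ x) * (v i ⬝ᵥ y) := by
  have hV : Matrix.of v * (Matrix.of v)ᵀ = 1 := by
    ext i j
    rw [Matrix.one_apply, ← horth i j]
    rfl
  have hV' : (Matrix.of v)ᵀ * Matrix.of v = 1 := mul_eq_one_comm.mp hV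
  calc x ⬝ᵥ y = x ⬝ᵥ ((Matrix.of v)ᵀ * Matrix.of v) *ᵥ y := by rw [hV', Matrix.one_mulVec]
    _ = (Matrix.of v *ᵥ x) ⬝ᵥ (Matrix.of v *ᵥ y) := by
      rw [← Matrix.mulVec_mulVec, Matrix.dotProduct_mulVec, Matrix.vecMul_transpose]
    _ = ∑ i, (v i ⬝ᵥ x) * (v i ⬝ᵥ y) := rfl

/-- A symmetric quadratic form expanded in an orthonormal eigenbasis. -/
theorem dotProduct_mulVec_eq_sum_eigenvalues {n : ℕ} {M : Matrix (Fin n) (Fin n) ℝ}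
    (hM : M.IsSymm) {lam : Fin n → ℝ} {v : Fin n → Fin n → ℝ}
    (heig : ∀ i, M *ᵥ v i = lam i • v i)
    (horth : ∀ i j, v i ⬝ᵥ v j = if i = j then (1 : ℝ) else 0) (x : Fin n → ℝ) :
    x ⬝ᵥ M *ᵥ x = ∑ i, lam i * (v i ⬝ᵥ x) ^ 2 := by
  rw [dotProduct_eq_sum_of_orthonormal horth]
  refine Finset.sum_congr rfl fun i _ => ?_
  rw [Matrix.dotProduct_mulVec (v i), ← Matrix.mulVec_transpose, hM.eq, heig, smul_dotProduct,
    smul_eq_mul]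
  ring

/-- The squared coordinates of a spin configuration in an orthonormal basis of `ℝⁿ` sum to `n`. -/
theorem sum_sq_dotProduct_of_spin {n : ℕ} {v : Fin n → Fin n → ℝ}
    (horth : ∀ i j, v i ⬝ᵥ v j = if i = j then (1 : ℝ) else 0)
    {σ : Fin n → ℝ} (hσ : ∀ i, σ i = 1 ∨ σ i = -1) :
    ∑ i, (v i ⬝ᵥ σ) ^ 2 = n := by
  have h : ∀ i, σ i * σ i = 1 := fun i => by rcases hσ i with h | h <;> simp [h]
  simp only [sq, ← dotProduct_eq_sum_of_orthonormal horth σ σ]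
  simp [dotProduct, h]

/-- On spin configurations the quadratic form of `a D - W` is the Ising energy up to an affine
change. -/
theorem dotProduct_smul_degMat_sub_mulVec {n : ℕ} (W : Matrix (Fin n) (Fin n) ℝ) (a : ℝ)
    {σ : Fin n → ℝ} (hσ : ∀ i, σ i = 1 ∨ σ i = -1) :
    σ ⬝ᵥ (a • degMat W - W) *ᵥ σ = a * (∑ i, ∑ j, W i j) - 2 * isingH W σ := by
  have hD : σ ⬝ᵥ degMat W *ᵥ σ = ∑ i, ∑ j, W i j := by
    refine Finset.sum_congr rfl fun i _ => ?_
    rw [degMat, Matrix.mulVec_diagonal]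
    rcases hσ i with h | h <;> simp [h]
  rw [Matrix.sub_mulVec, dotProduct_sub, Matrix.smul_mulVec, dotProduct_smul, hD, smul_eq_mul,
    isingH]
  ring

/-- dimension `N+1 ≥ 1`: with `λ̃_1 ≤ … ≤ λ̃_{N+1}` the
eigenvalues of `M(α) = (1−2α)D − W` and `v_1,…,v_{N+1}` a corresponding
orthonormal eigenbasis, `σ⋆` a minimizer of `H`, `H₁` the first excited level,
`c = λ_max(J_HyIM(σ⋆,α))`, `Δ_HyIM(α) = (1/2)(λ̃_max + c)`: if `λ̃_i + c ≥ 0`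
for all `i`, `Δ_HyIM(α) > 0`, no component of `v_max` vanishes and
`S(v_max) = (1/N)(v_maxᵀσ_max)² > 1 − ΔH/(N·Δ_HyIM(α))`,
then `H(σ_max) < H₁` where `σ_max = sign(v_max)`. -/
theorem stmt16 {N : ℕ} (W : Matrix (Fin (N+1)) (Fin (N+1)) ℝ)
    (hsymm : W.IsSymm) (h01 : ∀ i j, W i j = 0 ∨ W i j = 1)
    (hdiag : ∀ i, W i i = 0)
    (α : ℝ) (hα : α ∈ Set.Icc (0:ℝ) 1)
    (lam : Fin (N+1) → ℝ) (v : Fin (N+1) → Fin (N+1) → ℝ)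
    (hmono : Monotone lam)
    (heig : ∀ i, ((1 - 2*α) • degMat W - W).mulVec (v i) = lam i • v i)
    (horth : ∀ i j, v i ⬝ᵥ v j = if i = j then (1:ℝ) else 0)
    (σstar : Fin (N+1) → ℝ) (hspin : ∀ i, σstar i = 1 ∨ σstar i = -1)
    (hmin : ∀ σ : Fin (N+1) → ℝ, (∀ i, σ i = 1 ∨ σ i = -1) →
      isingH W σstar ≤ isingH W σ)
    (H₁ : ℝ)
    (hH₁mem : ∃ σ : Fin (N+1) → ℝ, (∀ i, σ i = 1 ∨ σ i = -1) ∧ isingH W σ = H₁)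
    (hH₁gt : isingH W σstar < H₁)
    (hH₁min : ∀ σ : Fin (N+1) → ℝ, (∀ i, σ i = 1 ∨ σ i = -1) →
      isingH W σstar < isingH W σ → H₁ ≤ isingH W σ)
    (c : ℝ) (hc : IsMaxEig (JHyIM W σstar α) c)
    (hpos : ∀ i, 0 ≤ lam i + c)
    (hgap : 0 < (1/2) * (lam (Fin.last N) + c))
    (hvnz : ∀ i, v (Fin.last N) i ≠ 0)
    (hS : 1 - (H₁ - isingH W σstar) / ((N + 1 : ℝ) * ((1/2) * (lam (Fin.last N) + c)))
        < (1/(N + 1 : ℝ)) *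
          ((v (Fin.last N)) ⬝ᵥ (fun i => Real.sign (v (Fin.last N) i)))^2) :
    isingH W (fun i => Real.sign (v (Fin.last N) i)) < H₁ := by
  have hs : ∀ i, Real.sign (v (Fin.last N) i) = 1 ∨ Real.sign (v (Fin.last N) i) = -1 :=
    fun i => (Real.sign_apply_eq_of_ne_zero _ (hvnz i)).symm
  set s : Fin (N + 1) → ℝ := fun i => Real.sign (v (Fin.last N) i)
  have hM : ((1 - 2 * α) • degMat W - W).IsSymm :=
    ((Matrix.isSymm_diagonal _).smul _).sub hsymm
  have hform_star := dotProduct_mulVec_eq_sum_eigenvalues hM heig horth σstar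
  have hform_s := dotProduct_mulVec_eq_sum_eigenvalues hM heig horth s
  rw [dotProduct_smul_degMat_sub_mulVec W _ hspin] at hform_star
  rw [dotProduct_smul_degMat_sub_mulVec W _ hs] at hform_s
  have hnorm_star : ∑ i, (v i ⬝ᵥ σstar) ^ 2 = (N + 1 : ℝ) :=
    mod_cast sum_sq_dotProduct_of_spin horth hspin
  have hnorm_s : ∑ i, (v i ⬝ᵥ s) ^ 2 = (N + 1 : ℝ) :=
    mod_cast sum_sq_dotProduct_of_spin horth hs
  have hupper : ∑ i, lam i * (v i ⬝ᵥ σstar) ^ 2 ≤ lam (Fin.last N) * (N + 1 : ℝ) := by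
    rw [← hnorm_star, Finset.mul_sum]
    exact Finset.sum_le_sum fun i _ =>
      mul_le_mul_of_nonneg_right (hmono (Fin.le_last i)) (sq_nonneg _)
  have hlower : (lam (Fin.last N) + c) * (v (Fin.last N) ⬝ᵥ s) ^ 2 ≤
      ∑ i, lam i * (v i ⬝ᵥ s) ^ 2 + c * (N + 1 : ℝ) := by
    rw [← hnorm_s, Finset.mul_sum, ← Finset.sum_add_distrib]
    simp only [← add_mul]
    exact Finset.single_le_sum (f := fun i => (lam i + c) * (v i ⬝ᵥ s) ^ 2)
      (fun i _ => mul_nonneg (hpos i) (sq_nonneg _)) (Finset.mem_univ (Fin.last N))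
  have hN : (0 : ℝ) < N + 1 := by positivity
  have hsync : (N + 1 : ℝ) * ((1 / 2) * (lam (Fin.last N) + c)) - (H₁ - isingH W σstar) <
      (1 / 2) * (lam (Fin.last N) + c) * (v (Fin.last N) ⬝ᵥ s) ^ 2 := by
    have h := mul_lt_mul_of_pos_left hS (mul_pos hN hgap)
    rw [mul_sub, mul_one, mul_div_cancel₀ _ (mul_pos hN hgap).ne'] at h
    refine h.trans_eq ?_
    field_simp
  linarith
end

section
/- The function E is differentiable on ℝ^N and for every φ ∈ ℝ^N and every index k, its partial derivative satisfies ∂E/∂φ_k(φ) = −( K·Σ_{j≠k} W_kj·[α·sin(φ_k + φ_j) + (1−α)·sin(φ_k − φ_j)] − K_s·sin(2φ_k) ); hence the HyIM dynamics dφ_i/dt = K·Σ_j W_ij·[α·sin(φ_i + φ_j) + (1−α)·sin(φ_i − φ_j)] − K_s·sin(2φ_i) coincide with the negative gradient flow of E. -/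
open Matrix Finset

/-- HyIM energy function
`E(φ) = (K/2)·Σ_i Σ_{j≠i} W_ij·[α·cos(φ_i+φ_j) + (1−α)·cos(φ_i−φ_j)]
      − (K_s/2)·Σ_i cos(2φ_i)`. -/
noncomputable def EHyIM {N : ℕ} (W : Matrix (Fin N) (Fin N) ℝ) (K Ks α : ℝ)
    (φ : Fin N → ℝ) : ℝ :=
  (K/2) * ∑ i, ∑ j ∈ Finset.univ.erase i,
      W i j * (α * Real.cos (φ i + φ j) + (1 - α) * Real.cos (φ i - φ j))
    - (Ks/2) * ∑ i, Real.cos (2 * φ i)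

/-- Erasing the diagonal term from a row sum weighted by a hollow matrix has no effect. -/
theorem sum_erase_of_diag_eq_zero {ι R : Type*} [Fintype ι] [DecidableEq ι]
    [NonUnitalNonAssocSemiring R]
    {W : Matrix ι ι R} (hdiag : ∀ i, W i i = 0) (i : ι) (f : ι → R) :
    ∑ j ∈ Finset.univ.erase i, W i j * f j = ∑ j, W i j * f j :=
  Finset.sum_erase _ (by simp [hdiag])

theorem differentiable_EHyIM {N : ℕ} (W : Matrix (Fin N) (Fin N) ℝ) (K Ks α : ℝ) :
    Differentiable ℝ (EHyIM W K Ks α) := by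
  unfold EHyIM
  fun_prop

/-- The derivative of the energy along the line through `φ` with direction `v`. -/
theorem hasLineDerivAt_EHyIM {N : ℕ} (W : Matrix (Fin N) (Fin N) ℝ) (K Ks α : ℝ)
    (φ v : Fin N → ℝ) :
    HasLineDerivAt ℝ (EHyIM W K Ks α)
      ((K/2) * ∑ i, ∑ j ∈ Finset.univ.erase i,
          W i j * (α * (-Real.sin (φ i + φ j) * (v i + v j))
            + (1 - α) * (-Real.sin (φ i - φ j) * (v i - v j)))
        - (Ks/2) * ∑ i, -Real.sin (2 * φ i) * (2 * v i)) φ v := by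
  have h (i : Fin N) : HasDerivAt (fun t : ℝ => φ i + t * v i) (v i) 0 := by
    simpa using ((hasDerivAt_id (0 : ℝ)).mul_const (v i)).const_add (φ i)
  unfold HasLineDerivAt EHyIM
  simp only [Pi.add_apply, Pi.smul_apply, smul_eq_mul]
  refine .sub (.const_mul _ (.fun_sum fun i _ => .fun_sum fun j _ => .const_mul _
    (.add (.const_mul _ ?_) (.const_mul _ ?_)))) (.const_mul _ (.fun_sum fun i _ => ?_))
  · simpa using ((h i).add (h j)).cos
  · simpa using ((h i).sub (h j)).cos
  · simpa using ((h i).const_mul 2).cos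

/-- For a symmetric coupling the two arguments of the pair interaction contribute equally to the
directional derivative. -/
theorem sum_pair_interaction_eq {N : ℕ} {W : Matrix (Fin N) (Fin N) ℝ} (hsymm : W.IsSymm)
    (α : ℝ) (φ v : Fin N → ℝ) :
    ∑ i, ∑ j, W i j * (α * (-Real.sin (φ i + φ j) * (v i + v j))
        + (1 - α) * (-Real.sin (φ i - φ j) * (v i - v j))) =
      -2 * ∑ i, v i * ∑ j, W i j *
        (α * Real.sin (φ i + φ j) + (1 - α) * Real.sin (φ i - φ j)) := by
  let g (i j : Fin N) : ℝ :=
    v i * (W i j * (α * Real.sin (φ i + φ j) + (1 - α) * Real.sin (φ i - φ j)))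
  have h (i j : Fin N) : W i j * (α * (-Real.sin (φ i + φ j) * (v i + v j))
      + (1 - α) * (-Real.sin (φ i - φ j) * (v i - v j))) = -g i j - g j i := by
    simp only [g, hsymm.apply i j, add_comm (φ j), ← neg_sub (φ i) (φ j), Real.sin_neg]
    ring
  have hg : ∑ i, v i * ∑ j, W i j *
      (α * Real.sin (φ i + φ j) + (1 - α) * Real.sin (φ i - φ j)) = ∑ i, ∑ j, g i j := by
    simp only [g, Finset.mul_sum]
  simp only [h, hg, Finset.sum_sub_distrib, Finset.sum_neg_distrib]
  rw [Finset.sum_comm (f := fun i j => g j i)]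
  ring

/-- `E` is differentiable on `ℝ^N`, and its partial derivative in
the `k`-th coordinate equals
`−(K·Σ_{j≠k} W_kj·[α·sin(φ_k+φ_j) + (1−α)·sin(φ_k−φ_j)] − K_s·sin(2φ_k))`;
hence the HyIM dynamics coincide with the negative gradient flow of `E`. -/
theorem stmt19 {N : ℕ} (W : Matrix (Fin N) (Fin N) ℝ)
    (hsymm : W.IsSymm) (hdiag : ∀ i, W i i = 0)
    (K Ks α : ℝ) (hα : α ∈ Set.Icc (0:ℝ) 1) :
    Differentiable ℝ (EHyIM W K Ks α) ∧
    ∀ (φ : Fin N → ℝ) (k : Fin N),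
      fderiv ℝ (EHyIM W K Ks α) φ (Pi.single k 1) =
        -(K * ∑ j ∈ Finset.univ.erase k,
            W k j * (α * Real.sin (φ k + φ j) + (1 - α) * Real.sin (φ k - φ j))
          - Ks * Real.sin (2 * φ k)) := by
  refine ⟨differentiable_EHyIM W K Ks α, fun φ k => ?_⟩
  rw [← (differentiable_EHyIM W K Ks α φ).lineDeriv_eq_fderiv,
    (hasLineDerivAt_EHyIM W K Ks α φ (Pi.single k 1)).lineDeriv]
  simp only [sum_erase_of_diag_eq_zero hdiag]
  rw [sum_pair_interaction_eq hsymm]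
  simp only [Pi.single_apply, ite_mul, mul_ite, one_mul, mul_one, zero_mul, mul_zero,
    Finset.sum_ite_eq', Finset.mem_univ, if_true]
  ring
end
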